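/- arXiv:0902.0120 — 7 statements merged into one kernel-verified Lean document; each statement's English description precedes it below -/
import Mathlib

section
/- If A is a nonzero finite-dimensional semiprime algebra over a field F (not assumed to have a unity), then there exists an idempotent e ∈ A such that the corner algebra e A e = {e a e | a ∈ A} is a division algebra. -/
section MinimalLeftIdeal

variable {F A : Type*} [Field F] [NonUnitalRing A] [Module F A]

/-- A nonzero finite-dimensional algebra has a minimal nonzero left ideal. -/
theorem exists_minimal_leftIdeal [FiniteDimensional F A] [Nontrivial A] :
    ∃ L : Submodule F A, Minimal (fun I ↦ I ≠ ⊥ ∧ ∀ x : A, ∀ y ∈ I, x * y ∈ I) L := by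
  obtain ⟨L, hL⟩ := exists_minimal_of_wellFoundedLT
    (fun I : Submodule F A ↦ I ≠ ⊥ ∧ ∀ x : A, ∀ y ∈ I, x * y ∈ I)
    ⟨⊤, top_ne_bot, fun _ _ _ ↦ Submodule.mem_top⟩
  exact ⟨L, hL⟩

variable [IsScalarTower F A A] {L : Submodule F A}

/-- Right multiplication by an element of a minimal left ideal `L` maps `L` onto `L`
unless it vanishes on `L`. -/
theorem exists_mul_eq_of_minimal_leftIdeal
    (hL : Minimal (fun I ↦ I ≠ ⊥ ∧ ∀ x : A, ∀ y ∈ I, x * y ∈ I) L)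
    {a b c : A} (ha : a ∈ L) (hb : b ∈ L) (hab : a * b ≠ 0) (hc : c ∈ L) :
    ∃ l ∈ L, l * b = c := by
  have hle : L ≤ L.map (LinearMap.mulRight F b) := by
    refine hL.2 ⟨fun h ↦ hab ?_, ?_⟩ ?_
    · have : a * b ∈ L.map (LinearMap.mulRight F b) := ⟨a, ha, rfl⟩
      rwa [h, Submodule.mem_bot] at this
    · rintro x _ ⟨l, hl, rfl⟩
      exact ⟨x * l, hL.1.2 x l hl, mul_assoc x l b⟩
    · rintro _ ⟨l, _, rfl⟩
      exact hL.1.2 l b hb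
  obtain ⟨l, hl, h⟩ := hle hc
  exact ⟨l, hl, h⟩

/-- Right multiplication by an element is injective on a minimal left ideal `L`
unless it vanishes on `L`. -/
theorem eq_zero_of_mul_eq_zero_of_minimal_leftIdeal
    (hL : Minimal (fun I ↦ I ≠ ⊥ ∧ ∀ x : A, ∀ y ∈ I, x * y ∈ I) L)
    {a b c : A} (ha : a ∈ L) (hab : a * b ≠ 0) (hc : c ∈ L) (hcb : c * b = 0) :
    c = 0 := by
  by_contra hc0
  have hle : L ≤ L ⊓ LinearMap.ker (LinearMap.mulRight F b) := by
    refine hL.2 ⟨fun h ↦ hc0 ?_, ?_⟩ inf_le_left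
    · have : c ∈ L ⊓ LinearMap.ker (LinearMap.mulRight F b) := ⟨hc, hcb⟩
      rwa [h, Submodule.mem_bot] at this
    · rintro x y ⟨hy, hyb⟩
      replace hyb : y * b = 0 := hyb
      refine ⟨hL.1.2 x y hy, ?_⟩
      change x * y * b = 0
      rw [mul_assoc, hyb, mul_zero]
  exact hab (hle ha).2

end MinimalLeftIdeal

/-- If every nonzero element of the corner `e A e` has a left inverse there, then every
nonzero element has a two-sided inverse. -/
theorem exists_corner_inverse_of_left_inverse {A : Type*} [NonUnitalRing A] {e : A}
    (he : e * e = e) (he0 : e ≠ 0)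
    (h : ∀ a : A, e * a * e ≠ 0 → ∃ b : A, (e * b * e) * (e * a * e) = e)
    (a : A) (ha : e * a * e ≠ 0) :
    ∃ b : A, (e * a * e) * (e * b * e) = e ∧ (e * b * e) * (e * a * e) = e := by
  obtain ⟨b, hb⟩ := h a ha
  obtain ⟨c, hc⟩ := h b fun hb0 ↦ he0 (by rw [← hb, hb0, zero_mul])
  have hca : e * c * e = e * a * e := calc
    e * c * e = e * c * (e * e) := by rw [he]
    _ = (e * c * e) * ((e * b * e) * (e * a * e)) := by rw [hb, mul_assoc (e * c)]
    _ = e * (e * a * e) := by rw [← mul_assoc, hc]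
    _ = e * a * e := by rw [← mul_assoc, ← mul_assoc, he]
  exact ⟨b, hca ▸ hc, hb⟩

/-- If `A` is a nonzero finite-dimensional semiprime (not necessarily unital) algebra
over a field `F`, then there is an idempotent `e ∈ A` such that the corner algebra
`e A e` is a division algebra: it has unity `e` (necessarily nonzero), and every
nonzero element `e a e` has a two-sided inverse in `e A e`. -/
theorem exists_idempotent_corner_division
    (F : Type) [Field F] (A : Type) [NonUnitalRing A] [Module F A]
    [SMulCommClass F A A] [IsScalarTower F A A]
    [FiniteDimensional F A] [Nontrivial A]
    (hsemiprime : ∀ a : A, (∀ x : A, a * x * a = 0) → a = 0) :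
    ∃ e : A, e * e = e ∧ e ≠ 0 ∧
      ∀ a : A, e * a * e ≠ 0 →
        ∃ b : A, (e * a * e) * (e * b * e) = e ∧ (e * b * e) * (e * a * e) = e := by
  obtain ⟨L, hL⟩ := exists_minimal_leftIdeal (F := F) (A := A)
  obtain ⟨a, ha, ha0⟩ := L.exists_mem_ne_zero_of_ne_bot hL.1.1
  obtain ⟨x, hx⟩ : ∃ x, a * x * a ≠ 0 := by
    by_contra! h
    exact ha0 (hsemiprime a h)
  rw [mul_assoc] at hx
  have hb : x * a ∈ L := hL.1.2 x a ha
  obtain ⟨e, he, heb⟩ := exists_mul_eq_of_minimal_leftIdeal hL ha hb hx hb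
  have hee : e * e = e := sub_eq_zero.mp <|
    eq_zero_of_mul_eq_zero_of_minimal_leftIdeal hL ha hx
      (L.sub_mem (hL.1.2 e e he) he) (by rw [sub_mul, mul_assoc, heb, heb, sub_self])
  have he0 : e ≠ 0 := by
    rintro rfl
    rw [← heb, zero_mul, mul_zero] at hx
    exact hx rfl
  refine ⟨e, hee, he0, exists_corner_inverse_of_left_inverse hee he0 fun c hc ↦ ?_⟩
  have hec : e * (e * c * e) = e * c * e := by rw [← mul_assoc, ← mul_assoc, hee]
  obtain ⟨l, -, hl⟩ := exists_mul_eq_of_minimal_leftIdeal hL he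
    (hL.1.2 (e * c) e he) (hec.symm ▸ hc) he
  exact ⟨l, by rw [mul_assoc (e * l), hec, mul_assoc e l, hl, hee]⟩
end

section
/- Let e be a nontrivial idempotent in a prime algebra A over a field F (A not assumed to have a unity; 'nontrivial' means e ≠ 0, and e is not a unity of A). Then the set Â = {a − ea − ae + eae | a ∈ A} is a nonzero prime subalgebra of A, and e ∉ Â. -/
/-- The set `Â = {a - ea - ae + eae | a ∈ A}`, a "corner" simulating
`(1 - e) A (1 - e)` in an algebra without unity. -/
def hatSet (A : Type) [NonUnitalRing A] (e : A) : Set A :=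
  {x : A | ∃ a : A, x = a - e * a - a * e + e * a * e}

/-- The corner `Â` consists of the elements annihilated by `e` on both sides. -/
theorem mem_hatSet_iff {A : Type} [NonUnitalRing A] {e : A} (he : e * e = e) {x : A} :
    x ∈ hatSet A e ↔ e * x = 0 ∧ x * e = 0 := by
  constructor
  · rintro ⟨a, rfl⟩
    constructor
    · simp only [mul_add, mul_sub, ← mul_assoc, he]
      abel
    · simp only [add_mul, sub_mul, mul_assoc, he]
      abel
  · rintro ⟨h₁, h₂⟩
    exact ⟨x, by simp [h₁, h₂]⟩

/-- In a prime ring, a nonzero right identity is also a left identity. -/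
theorem mul_eq_of_forall_mul_eq_of_prime {A : Type} [NonUnitalRing A]
    (hprime : ∀ a b : A, (∀ x : A, a * x * b = 0) → a = 0 ∨ b = 0)
    {e : A} (he0 : e ≠ 0) (h : ∀ a : A, a * e = a) (a : A) : e * a = a := by
  refine sub_eq_zero.mp ((hprime e (e * a - a) fun x => ?_).resolve_left he0)
  rw [mul_sub, ← mul_assoc, h, sub_self]

/-- In a prime ring, a nonzero left identity is also a right identity. -/
theorem eq_mul_of_forall_mul_eq_of_prime {A : Type} [NonUnitalRing A]
    (hprime : ∀ a b : A, (∀ x : A, a * x * b = 0) → a = 0 ∨ b = 0)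
    {e : A} (he0 : e ≠ 0) (h : ∀ a : A, e * a = a) (a : A) : a * e = a := by
  refine sub_eq_zero.mp ((hprime (a * e - a) e fun x => ?_).resolve_right he0)
  rw [sub_mul, mul_assoc a, h, sub_self, zero_mul]

/-- In a prime ring, if the corner `Â` of a nonzero `e` vanishes, then `e` is a unity. -/
theorem isUnity_of_hatSet_eq_zero {A : Type} [NonUnitalRing A]
    (hprime : ∀ a b : A, (∀ x : A, a * x * b = 0) → a = 0 ∨ b = 0)
    {e : A} (he0 : e ≠ 0) (h : ∀ x ∈ hatSet A e, x = 0) (a : A) :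
    e * a = a ∧ a * e = a := by
  have key (a b : A) : a - e * a = 0 ∨ b - b * e = 0 := by
    refine hprime _ _ fun x => ?_
    rw [← h _ ⟨a * x * b, rfl⟩]
    simp only [mul_sub, sub_mul, mul_assoc]
    abel
  by_cases hl : ∀ a : A, e * a = a
  · exact ⟨hl a, eq_mul_of_forall_mul_eq_of_prime hprime he0 hl a⟩
  · push Not at hl
    obtain ⟨c, hc⟩ := hl
    have hr (b : A) : b * e = b :=
      (sub_eq_zero.mp ((key c b).resolve_left fun h0 => hc (sub_eq_zero.mp h0).symm)).symm
    exact ⟨mul_eq_of_forall_mul_eq_of_prime hprime he0 hr a, hr a⟩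

/-- If `e` is a nontrivial idempotent in a prime (not necessarily unital) algebra `A`
over a field `F`, then `Â = {a - ea - ae + eae | a ∈ A}` is a nonzero prime
subalgebra of `A` not containing `e`. -/
theorem hatSet_prime_subalgebra
    (F : Type) [Field F] (A : Type) [NonUnitalRing A] [Module F A]
    [SMulCommClass F A A] [IsScalarTower F A A]
    (hprime : ∀ a b : A, (∀ x : A, a * x * b = 0) → a = 0 ∨ b = 0)
    (e : A) (he : e * e = e) (he0 : e ≠ 0)
    (hne1 : ¬ ∀ a : A, e * a = a ∧ a * e = a) :
    (∃ x ∈ hatSet A e, x ≠ 0) ∧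
    e ∉ hatSet A e ∧
    (∀ x ∈ hatSet A e, ∀ y ∈ hatSet A e, x + y ∈ hatSet A e) ∧
    (∀ c : F, ∀ x ∈ hatSet A e, c • x ∈ hatSet A e) ∧
    (∀ x ∈ hatSet A e, ∀ y ∈ hatSet A e, x * y ∈ hatSet A e) ∧
    (∀ a ∈ hatSet A e, ∀ b ∈ hatSet A e,
      (∀ x ∈ hatSet A e, a * x * b = 0) → a = 0 ∨ b = 0) := by
  simp only [mem_hatSet_iff he]
  refine ⟨?_, fun h => he0 (he ▸ h.1), ?_, ?_, ?_, ?_⟩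
  · by_contra! h
    exact hne1 (isUnity_of_hatSet_eq_zero hprime he0
      fun x hx => h x ((mem_hatSet_iff he).mp hx))
  · rintro x ⟨hx₁, hx₂⟩ y ⟨hy₁, hy₂⟩
    simp [mul_add, add_mul, hx₁, hx₂, hy₁, hy₂]
  · rintro c x ⟨hx₁, hx₂⟩
    simp [mul_smul_comm, smul_mul_assoc, hx₁, hx₂]
  · rintro x ⟨hx₁, -⟩ y ⟨-, hy₂⟩
    exact ⟨by rw [← mul_assoc, hx₁, zero_mul], by rw [mul_assoc, hy₂, mul_zero]⟩
  · rintro a ⟨-, ha⟩ b ⟨hb, -⟩ h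
    refine hprime a b fun x => ?_
    have hx := h _ ((mem_hatSet_iff he).mp ⟨x, rfl⟩)
    simpa [mul_add, mul_sub, add_mul, sub_mul, mul_assoc, hb, ← mul_assoc a e, ha] using hx
end

section
/- Let e be a nontrivial idempotent in a prime algebra A over a field F (A not assumed to have a unity), and let Â = {a − ea − ae + eae | a ∈ A}. If the subalgebra Â has a unity 1_Â, then A has a unity as well, and 1_A = e + 1_Â. -/
theorem idempotent_mul_hatSet {A : Type} [NonUnitalRing A] {e x : A} (he : e * e = e)
    (hx : x ∈ hatSet A e) : e * x = 0 := by
  obtain ⟨a, rfl⟩ := hx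
  simp [mul_sub, mul_add, ← mul_assoc, he]

theorem hatSet_mul_idempotent {A : Type} [NonUnitalRing A] {e x : A} (he : e * e = e)
    (hx : x ∈ hatSet A e) : x * e = 0 := by
  obtain ⟨a, rfl⟩ := hx
  simp [sub_mul, add_mul, mul_assoc, he]

/-- If `u` is a right unity of `Â` and `e * c = u * c = 0`, then `u * y * c = 0` for all `y`. -/
theorem unity_mul_mul_eq_zero {A : Type} [NonUnitalRing A] {e u c : A}
    (hue : u * e = 0) (hu : ∀ x ∈ hatSet A e, x * u = x) (hec : e * c = 0)
    (huc : u * c = 0) (y : A) : u * y * c = 0 := by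
  have h : (y - e * y - y * e + e * y * e) * c = 0 := by
    rw [← hu _ ⟨y, rfl⟩, mul_assoc, huc, mul_zero]
  have hyc : y * c = e * (y * c) := by
    simpa [sub_mul, add_mul, mul_assoc, hec, sub_eq_zero] using h
  rw [mul_assoc, hyc, ← mul_assoc, hue, zero_mul]

/-- If `u` is a left unity of `Â` and `c * e = c * u = 0`, then `c * y * u = 0` for all `y`. -/
theorem mul_mul_unity_eq_zero {A : Type} [NonUnitalRing A] {e u c : A}
    (heu : e * u = 0) (hu : ∀ x ∈ hatSet A e, u * x = x) (hce : c * e = 0)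
    (hcu : c * u = 0) (y : A) : c * y * u = 0 := by
  have h : c * (y - e * y - y * e + e * y * e) = 0 := by
    rw [← hu _ ⟨y, rfl⟩, ← mul_assoc, hcu, zero_mul]
  have hcy : c * y = c * y * e := by
    simpa [mul_sub, mul_add, ← mul_assoc, hce, sub_eq_zero] using h
  rw [hcy, mul_assoc, heu, mul_zero]

/-- Let `e` be a nontrivial idempotent in a prime (not necessarily unital) algebra `A`
over a field `F`, and let `Â = {a - ea - ae + eae | a ∈ A}`. If `Â` has a unity `u`,
then `A` has a unity as well, namely `e + u`. -/
theorem hatSet_unity_extends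
    (F : Type) [Field F] (A : Type) [NonUnitalRing A] [Module F A]
    [SMulCommClass F A A] [IsScalarTower F A A]
    (hprime : ∀ a b : A, (∀ x : A, a * x * b = 0) → a = 0 ∨ b = 0)
    (e : A) (he : e * e = e) (he0 : e ≠ 0)
    (hne1 : ¬ ∀ a : A, e * a = a ∧ a * e = a)
    (u : A) (hu : u ∈ hatSet A e) (hu0 : u ≠ 0)
    (huone : ∀ x ∈ hatSet A e, u * x = x ∧ x * u = x) :
    e + u ≠ 0 ∧ ∀ a : A, (e + u) * a = a ∧ a * (e + u) = a := by
  have heu : e * u = 0 := idempotent_mul_hatSet he hu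
  have hue : u * e = 0 := hatSet_mul_idempotent he hu
  have huu : u * u = u := (huone u hu).1
  refine ⟨fun h => he0 ?_, fun a => ⟨?_, ?_⟩⟩
  · simpa [mul_add, he, heu] using congrArg (e * ·) h
  · have hc := (hprime u (a - (e + u) * a) (unity_mul_mul_eq_zero hue (fun x hx => (huone x hx).2)
      (by simp [mul_sub, add_mul, mul_add, ← mul_assoc, he, heu])
      (by simp [mul_sub, add_mul, mul_add, ← mul_assoc, hue, huu]))).resolve_left hu0
    exact (sub_eq_zero.mp hc).symm
  · have hc := (hprime (a - a * (e + u)) u (mul_mul_unity_eq_zero heu (fun x hx => (huone x hx).1)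
      (by simp [sub_mul, add_mul, mul_add, mul_assoc, he, hue])
      (by simp [sub_mul, add_mul, mul_add, mul_assoc, heu, huu]))).resolve_right hu0
    exact (sub_eq_zero.mp hc).symm
end

section
/- Every nonzero finite-dimensional prime algebra over a field F has a unity element. -/
/-- In a finite-dimensional semiprime algebra every nonzero right ideal contains a nonzero
idempotent. -/
theorem exists_isIdempotentElem_mem_of_rightIdeal {F A : Type*}
    [Field F] [NonUnitalRing A] [Module F A]
    [SMulCommClass F A A] [FiniteDimensional F A]
    (hsemiprime : ∀ a : A, (∀ x : A, a * x * a = 0) → a = 0) (I : Submodule F A)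
    (hI : ∀ a ∈ I, ∀ x : A, a * x ∈ I) (hne : I ≠ ⊥) :
    ∃ e ∈ I, e ≠ 0 ∧ IsIdempotentElem e := by
  induction I using WellFoundedLT.induction with
  | ind I ih =>
    by_cases hmin : ∃ J < I, (∀ a ∈ J, ∀ x : A, a * x ∈ J) ∧ J ≠ ⊥
    · obtain ⟨J, hJI, hJ, hJne⟩ := hmin
      obtain ⟨e, he, h⟩ := ih J hJI hJ hJne
      exact ⟨e, hJI.le he, h⟩
    push Not at hmin
    obtain ⟨b, hb, hb0⟩ := I.ne_bot_iff.mp hne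
    obtain ⟨a, ha, r, hr, har⟩ : ∃ a ∈ I, ∃ r ∈ I, a * r ≠ 0 := by
      by_contra! h
      exact hb0 (hsemiprime b fun x => h _ (hI b hb x) b hb)
    have hmap : I.map (LinearMap.mulLeft F a) = I := by
      have hle : I.map (LinearMap.mulLeft F a) ≤ I := by
        rintro _ ⟨s, -, rfl⟩
        exact hI a ha s
      refine hle.eq_of_not_lt fun hlt => har ?_
      have hbot := hmin _ hlt (by
        rintro _ ⟨s, hs, rfl⟩ x
        exact ⟨s * x, hI s hs x, (mul_assoc a s x).symm⟩)
      exact (Submodule.mem_bot F).mp (hbot ▸ Submodule.mem_map_of_mem hr)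
    have hker : I ⊓ LinearMap.ker (LinearMap.mulLeft F a) = ⊥ := by
      refine hmin _ (inf_le_left.lt_of_ne fun h => har ?_) ?_
      · exact (h.ge hr).2
      · rintro s ⟨hs, hs0⟩ x
        have hs0' : a * s = 0 := hs0
        refine ⟨hI s hs x, ?_⟩
        change a * (s * x) = 0
        rw [← mul_assoc, hs0', zero_mul]
    obtain ⟨e, he, hae⟩ : a ∈ I.map (LinearMap.mulLeft F a) := hmap.symm ▸ ha
    have hae' : a * e = a := hae
    refine ⟨e, he, ?_, ?_⟩
    · rintro rfl
      rw [mul_zero] at hae'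
      exact har (by rw [← hae', zero_mul])
    · have hmem : e * e - e ∈ I ⊓ LinearMap.ker (LinearMap.mulLeft F a) := by
        refine ⟨I.sub_mem (hI e he e) he, ?_⟩
        change a * (e * e - e) = 0
        rw [mul_sub, ← mul_assoc, hae', hae', sub_self]
      rw [hker, Submodule.mem_bot] at hmem
      exact sub_eq_zero.mp hmem

/-- A finite-dimensional semiprime algebra has a left identity. -/
theorem exists_left_identity_of_semiprime (F : Type*) {A : Type*}
    [Field F] [NonUnitalRing A] [Module F A]
    [SMulCommClass F A A] [FiniteDimensional F A]
    (hsemiprime : ∀ a : A, (∀ x : A, a * x * a = 0) → a = 0) :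
    ∃ e : A, ∀ x : A, e * x = x := by
  suffices h : ∀ (I : Submodule F A) (e : A), IsIdempotentElem e →
      LinearMap.ker (LinearMap.mulLeft F e) = I → ∃ e : A, ∀ x : A, e * x = x from
    h _ 0 (mul_zero 0) rfl
  intro I
  induction I using WellFoundedLT.induction with
  | ind I ih =>
    rintro e he rfl
    by_cases hbot : LinearMap.ker (LinearMap.mulLeft F e) = ⊥
    · refine ⟨e, fun x => ?_⟩
      apply LinearMap.ker_eq_bot.mp hbot
      change e * (e * x) = e * x
      rw [← mul_assoc, he.eq]
    obtain ⟨f, hf, hf0, hff⟩ := exists_isIdempotentElem_mem_of_rightIdeal hsemiprime _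
      (fun s hs x => by
        have hs' : e * s = 0 := hs
        change e * (s * x) = 0
        rw [← mul_assoc, hs', zero_mul]) hbot
    have hef : e * f = 0 := hf
    have heg : e * (e + f - f * e) = e := by
      rw [mul_sub, mul_add, ← mul_assoc, hef, he.eq, zero_mul, add_zero, sub_zero]
    have hfg : f * (e + f - f * e) = f := by
      rw [mul_sub, mul_add, ← mul_assoc, hff.eq, add_sub_cancel_left]
    have hgf : (e + f - f * e) * f = f := by
      rw [sub_mul, add_mul, mul_assoc, hef, hff.eq, mul_zero, zero_add, sub_zero]
    refine ih _ ?_ (e + f - f * e) ?_ rfl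
    · refine SetLike.lt_iff_le_and_exists.mpr ⟨fun x hx => ?_, f, hf, fun h => hf0 ?_⟩
      · have hx' : (e + f - f * e) * x = 0 := hx
        change e * x = 0
        rw [← heg, mul_assoc, hx', mul_zero]
      · exact hgf.symm.trans h
    · change (e + f - f * e) * (e + f - f * e) = e + f - f * e
      rw [sub_mul, add_mul, mul_assoc f e, heg, hfg]

/-- Every nonzero finite-dimensional prime (not necessarily unital) algebra over a
field `F` has a unity element. -/
theorem prime_finiteDimensional_has_unity
    (F : Type) [Field F] (A : Type) [NonUnitalRing A] [Module F A]
    [SMulCommClass F A A] [IsScalarTower F A A]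
    [FiniteDimensional F A] [Nontrivial A]
    (hprime : ∀ a b : A, (∀ x : A, a * x * b = 0) → a = 0 ∨ b = 0) :
    ∃ u : A, u ≠ 0 ∧ ∀ a : A, u * a = a ∧ a * u = a := by
  obtain ⟨u, hu⟩ := exists_left_identity_of_semiprime F fun a h => or_self_iff.mp (hprime a a h)
  obtain ⟨b, hb⟩ := exists_ne (0 : A)
  refine ⟨u, ?_, fun a => ⟨hu a, ?_⟩⟩
  · rintro rfl
    exact hb (by rw [← hu b, zero_mul])
  · refine sub_eq_zero.mp ((hprime (a * u - a) b fun x => ?_).resolve_right hb)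
    rw [sub_mul, mul_assoc a u x, hu, sub_self, zero_mul]
end

section
/- Let A be a nonzero finite-dimensional algebra over a field F (not assumed to have a unity). Then A is prime if and only if there exist a positive integer n and a division algebra D over F such that A is isomorphic as an F-algebra to M_n(D). -/
theorem Ideal.eq_bot_of_pow_eq_bot_of_prime {R : Type*} [Ring R]
    (h : ∀ a b : R, (∀ x, a * x * b = 0) → a = 0 ∨ b = 0) {J : Ideal R} {n : ℕ}
    (hn : J ^ n = ⊥) : J = ⊥ := by
  induction n with
  | zero =>
    rw [Submodule.pow_zero, Ideal.one_eq_top] at hn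
    exact le_bot_iff.mp (hn ▸ le_top)
  | succ n ih =>
    by_contra hJ
    obtain ⟨b, hb, hb0⟩ := Submodule.exists_mem_ne_zero_of_ne_bot hJ
    refine hJ (ih <| (Submodule.eq_bot_iff _).mpr fun a ha ↦ (h a b fun x ↦ ?_).resolve_right hb0)
    have := Ideal.mul_mem_mul ha (J.mul_mem_left x hb)
    rwa [← mul_assoc a x b, ← Submodule.pow_succ, hn, Submodule.mem_bot] at this

theorem IsArtinianRing.isSemisimpleRing_of_prime {R : Type*} [Ring R] [IsArtinianRing R]
    (h : ∀ a b : R, (∀ x, a * x * b = 0) → a = 0 ∨ b = 0) : IsSemisimpleRing R := by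
  rw [IsArtinianRing.isSemisimpleRing_iff_jacobson]
  obtain ⟨n, hn⟩ := IsSemiprimaryRing.isNilpotent (R := R)
  exact Ideal.eq_bot_of_pow_eq_bot_of_prime h hn

/-- A prime Artinian ring is simple. -/
theorem IsArtinianRing.isSimpleRing_of_prime {R : Type*} [Ring R] [Nontrivial R] [IsArtinianRing R]
    (h : ∀ a b : R, (∀ x, a * x * b = 0) → a = 0 ∨ b = 0) : IsSimpleRing R := by
  have := isSemisimpleRing_of_prime h
  refine isSimpleRing_iff_isTwoSided_imp.mpr ⟨inferInstance, fun I hI ↦ ?_⟩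
  refine or_iff_not_imp_left.mpr fun hI0 ↦ ?_
  obtain ⟨C, hC⟩ := exists_isCompl I
  obtain ⟨a, ha, ha0⟩ := Submodule.exists_mem_ne_zero_of_ne_bot hI0
  have hC0 : C = ⊥ := by
    refine (Submodule.eq_bot_iff _).mpr fun c hc ↦ (h a c fun x ↦ ?_).resolve_left ha0
    have : a * x * c ∈ I ⊓ C :=
      ⟨I.mul_mem_right _ (I.mul_mem_right _ ha), C.mul_mem_left _ hc⟩
    rwa [hC.inf_eq_bot] at this
  simpa [hC0] using hC.sup_eq_top

theorem Matrix.prime_of_noZeroDivisors {n R : Type*} [Fintype n] [DecidableEq n] [Ring R]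
    [NoZeroDivisors R] {a b : Matrix n n R} (h : ∀ x, a * x * b = 0) : a = 0 ∨ b = 0 := by
  by_contra! H
  obtain ⟨ha, hb⟩ := H
  simp only [ne_eq, ← Matrix.ext_iff, not_forall, Matrix.zero_apply] at ha hb
  obtain ⟨i, j, ha⟩ := ha
  obtain ⟨k, l, hb⟩ := hb
  have := congr_fun₂ (h (Matrix.single j k 1)) i l
  simp [Matrix.mul_apply, Matrix.single_apply, ite_and, ha, hb] at this

/-- The algebra of endomorphisms of `A` generated by the left multiplications and the scalars. -/
noncomputable abbrev leftMulAlgebra (F A : Type*) [Field F] [NonUnitalRing A] [Module F A]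
    [SMulCommClass F A A] [IsScalarTower F A A] : Subalgebra F (Module.End F A) :=
  (Unitization.lift (NonUnitalAlgHom.lmul F A)).range

namespace leftMulAlgebra

variable {F A : Type*} [Field F] [NonUnitalRing A] [Module F A]
  [SMulCommClass F A A] [IsScalarTower F A A]

theorem apply_mul (r : leftMulAlgebra F A) (x y : A) : r.1 (x * y) = r.1 x * y := by
  obtain ⟨_, u, rfl⟩ := r
  induction u with
  | inl_add_inr c a => simp [Unitization.lift, mul_assoc, add_mul, smul_mul_assoc]

variable (F A) in
/-- Left multiplication, as a map into the algebra it generates. -/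
noncomputable def ofLeft : A →ₗ[F] leftMulAlgebra F A where
  toFun a := ⟨NonUnitalAlgHom.lmul F A a, Unitization.inr a, by simp [Unitization.lift]⟩
  map_add' _ _ := by ext; simp
  map_smul' _ _ := by ext; simp

@[simp]
theorem coe_ofLeft_apply (a x : A) : (ofLeft F A a).1 x = a * x := rfl

theorem ofLeft_mul (a b : A) : ofLeft F A (a * b) = ofLeft F A a * ofLeft F A b := by
  ext x
  simp [mul_assoc]

theorem mul_ofLeft (r : leftMulAlgebra F A) (a : A) : r * ofLeft F A a = ofLeft F A (r.1 a) := by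
  ext x
  simp [apply_mul]

theorem ofLeft_mul_mem (a : A) (r : leftMulAlgebra F A) :
    ofLeft F A a * r ∈ LinearMap.range (ofLeft F A) := by
  obtain ⟨_, u, rfl⟩ := r
  induction u with
  | inl_add_inr c b =>
    refine ⟨c • a + a * b, ?_⟩
    ext x
    simp [Unitization.lift, mul_assoc, mul_add]

variable (F A) in
/-- The left multiplications form a left ideal. -/
noncomputable def leftIdeal : Ideal (leftMulAlgebra F A) where
  __ := (LinearMap.range (ofLeft F A)).toAddSubmonoid
  smul_mem' := by
    rintro r _ ⟨a, rfl⟩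
    exact ⟨r.1 a, (mul_ofLeft r a).symm⟩

instance : (leftIdeal F A).IsTwoSided where
  mul_mem_of_left := by
    rintro _ r ⟨a, rfl⟩
    exact ofLeft_mul_mem a r

theorem ofLeft_injective (h : ∀ a b : A, (∀ x : A, a * x * b = 0) → a = 0 ∨ b = 0) :
    Function.Injective (ofLeft F A) := by
  refine (injective_iff_map_eq_zero _).mpr fun a ha ↦ ?_
  have ha' (x : A) : a * x = 0 := by rw [← coe_ofLeft_apply (F := F), ha]; rfl
  exact (h a a fun x ↦ by rw [ha', zero_mul]).elim id id

theorem prime (h : ∀ a b : A, (∀ x : A, a * x * b = 0) → a = 0 ∨ b = 0)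
    (r s : leftMulAlgebra F A) (hrs : ∀ t, r * t * s = 0) : r = 0 ∨ s = 0 := by
  by_contra! H
  obtain ⟨hr, hs⟩ := H
  obtain ⟨x, hx⟩ : ∃ x, r.1 x ≠ 0 := by
    by_contra! H
    exact hr (by ext; simp [H])
  obtain ⟨y, hy⟩ : ∃ y, s.1 y ≠ 0 := by
    by_contra! H
    exact hs (by ext; simp [H])
  refine (h _ _ fun z ↦ ?_).elim hx hy
  have := congr_arg (fun f ↦ f.1 y) (hrs (ofLeft F A (x * z)))
  simpa [apply_mul] using this

/-- A nonzero finite-dimensional prime algebra is isomorphic to the unital algebra generated by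
its left multiplications, which is simple. -/
theorem isSimpleRing_and_bijective_ofLeft [FiniteDimensional F A] [Nontrivial A]
    (h : ∀ a b : A, (∀ x : A, a * x * b = 0) → a = 0 ∨ b = 0) :
    IsSimpleRing (leftMulAlgebra F A) ∧ Function.Bijective (ofLeft F A) := by
  have : IsArtinianRing (leftMulAlgebra F A) := .of_finite F _
  have hs : IsSimpleRing (leftMulAlgebra F A) := IsArtinianRing.isSimpleRing_of_prime (prime h)
  refine ⟨hs, ofLeft_injective h, fun r ↦ ?_⟩
  obtain hI | hI := (isSimpleRing_iff_isTwoSided_imp.mp hs).2 (leftIdeal F A) inferInstance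
  · obtain ⟨a, ha⟩ := exists_ne (0 : A)
    have hmem : ofLeft F A a ∈ leftIdeal F A := ⟨a, rfl⟩
    rw [hI, Submodule.mem_bot] at hmem
    exact absurd (ofLeft_injective h (hmem.trans (map_zero _).symm)) ha
  · exact (hI ▸ Submodule.mem_top : r ∈ leftIdeal F A)

end leftMulAlgebra


/-- Wedderburn's theorem for prime algebras: a nonzero finite-dimensional
(not necessarily unital) algebra `A` over a field `F` is prime if and only if
`A ≅ Mₙ(D)` for some `n ≥ 1` and some division algebra `D` over `F`. The
isomorphism is expressed as an `F`-linear multiplicative bijection. -/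
theorem wedderburn_prime
    (F : Type) [Field F] (A : Type) [NonUnitalRing A] [Module F A]
    [SMulCommClass F A A] [IsScalarTower F A A]
    [FiniteDimensional F A] [Nontrivial A] :
    (∀ a b : A, (∀ x : A, a * x * b = 0) → a = 0 ∨ b = 0) ↔
      ∃ n : ℕ, 0 < n ∧
        ∃ (D : Type) (_ : DivisionRing D) (_ : Algebra F D),
          ∃ φ : A ≃ₗ[F] Matrix (Fin n) (Fin n) D,
            ∀ a b : A, φ (a * b) = φ a * φ b := by
  constructor
  · intro h
    obtain ⟨_, hb⟩ := leftMulAlgebra.isSimpleRing_and_bijective_ofLeft (F := F) h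
    have : IsArtinianRing (leftMulAlgebra F A) := .of_finite F _
    obtain ⟨n, hn, D, _, _, ⟨e⟩⟩ :=
      IsSimpleRing.exists_algEquiv_matrix_divisionRing F (leftMulAlgebra F A)
    refine ⟨n, Nat.pos_of_neZero n, D, inferInstance, inferInstance,
      (LinearEquiv.ofBijective _ hb).trans e.toLinearEquiv, fun a b ↦ ?_⟩
    simp [leftMulAlgebra.ofLeft_mul]
  · rintro ⟨n, -, D, _, _, φ, hφ⟩ a b h
    have := Matrix.prime_of_noZeroDivisors (a := φ a) (b := φ b) fun x ↦ by
      obtain ⟨x, rfl⟩ := φ.surjective x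
      rw [← hφ, ← hφ, h, map_zero]
    simpa using this
end

section
/- Let A be a nonzero finite-dimensional algebra over a field F (not assumed to have a unity). Then A is semiprime if and only if there exist a positive integer r, positive integers n_1, ..., n_r, and division algebras D_1, ..., D_r over F such that A is isomorphic as an F-algebra to the direct product M_{n_1}(D_1) × ... × M_{n_r}(D_r). -/
/-- In a semiprime ring, a nilpotent two-sided ideal vanishes. -/
theorem Ideal.eq_bot_of_isNilpotent_of_semiprime {R : Type*} [Ring R]
    (hR : ∀ x : R, (∀ y, x * y * x = 0) → x = 0) (I : Ideal R) [I.IsTwoSided]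
    (hI : IsNilpotent I) : I = ⊥ := by
  obtain ⟨n, hn⟩ := hI
  suffices ∀ n : ℕ, I ^ (n + 1) = ⊥ → I = ⊥ by
    refine this n ?_
    rw [Submodule.pow_succ, hn, Submodule.zero_eq_bot, Submodule.bot_mul]
  intro n
  induction n with
  | zero => simp [Submodule.pow_one]
  | succ n ih =>
    refine fun h => ih ((Submodule.eq_bot_iff _).2 fun x hx => hR x fun y => ?_)
    have hxy : x * y * x ∈ I ^ (n + 1) * I ^ (n + 1) :=
      Ideal.mul_mem_mul (Ideal.mul_mem_right y _ hx) hx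
    rw [← Ideal.IsTwoSided.pow_add] at hxy
    have := Ideal.pow_le_pow_right (I := I) (show n + 1 + 1 ≤ n + 1 + (n + 1) by lia) hxy
    rwa [h] at this

/-- The unitization of a semiprime algebra over a field is semiprime. -/
theorem Unitization.semiprime {F A : Type*} [Field F] [NonUnitalRing A] [Module F A]
    [SMulCommClass F A A] [IsScalarTower F A A]
    (hA : ∀ a : A, (∀ x : A, a * x * a = 0) → a = 0)
    (x : Unitization F A) (hx : ∀ y, x * y * x = 0) : x = 0 := by
  have hfst : x.fst = 0 := by
    have := congrArg (Unitization.fstHom F A) (hx 1)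
    simpa using this
  have hx' : x = (x.snd : Unitization F A) := by ext <;> simp [hfst]
  have hsnd : x.snd = 0 := by
    refine hA _ fun y => Unitization.inr_injective (R := F) ?_
    rw [Unitization.inr_mul, Unitization.inr_mul, ← hx', Unitization.inr_zero]
    exact hx y
  rw [hx', hsnd, Unitization.inr_zero]

/-- The unitization of a finite-dimensional semiprime algebra is semisimple. -/
theorem Unitization.isSemisimpleRing {F A : Type*} [Field F] [NonUnitalRing A] [Module F A]
    [SMulCommClass F A A] [IsScalarTower F A A] [FiniteDimensional F A]
    (hA : ∀ a : A, (∀ x : A, a * x * a = 0) → a = 0) :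
    IsSemisimpleRing (Unitization F A) := by
  have : Module.Finite F (Unitization F A) :=
    Module.Finite.equiv (Unitization.linearEquiv F F A).symm
  have : IsArtinianRing (Unitization F A) := IsArtinianRing.of_finite F _
  rw [IsArtinianRing.isSemisimpleRing_iff_jacobson]
  exact Ideal.eq_bot_of_isNilpotent_of_semiprime (Unitization.semiprime hA) _
    IsSemiprimaryRing.isNilpotent

/-- A finite-dimensional semiprime algebra has a unity element. -/
theorem exists_unity_of_semiprime (F : Type*) {A : Type*} [Field F] [NonUnitalRing A] [Module F A]
    [SMulCommClass F A A] [IsScalarTower F A A] [FiniteDimensional F A]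
    (hA : ∀ a : A, (∀ x : A, a * x * a = 0) → a = 0) :
    ∃ e : A, ∀ a : A, e * a = a ∧ a * e = a := by
  have := Unitization.isSemisimpleRing (F := F) hA
  let I : Ideal (Unitization F A) := RingHom.ker (Unitization.fstHom F A)
  have hI (x : Unitization F A) : x ∈ I ↔ x.fst = 0 := Iff.rfl
  obtain ⟨J, hJ⟩ := exists_isCompl I
  obtain ⟨u, hu, v, hv, huv⟩ := Submodule.mem_sup.1 (hJ.sup_eq_top ▸ Submodule.mem_top (x := 1))
  have hu' : u = (u.snd : Unitization F A) := by ext <;> simp [(hI u).1 hu]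
  have hright (a : A) : a * u.snd = a := by
    have h1 : (a : Unitization F A) * v = 0 := by
      refine Submodule.disjoint_def.1 hJ.disjoint _ ?_ (J.mul_mem_left _ hv)
      simp [hI]
    refine Unitization.inr_injective (R := F) ?_
    rw [Unitization.inr_mul, ← hu', ← add_zero (_ * u), ← h1, ← mul_add, huv, mul_one]
  refine ⟨u.snd, fun a => ⟨sub_eq_zero.1 (hA _ fun x => ?_), hright a⟩⟩
  rw [mul_assoc, mul_sub, ← mul_assoc x, hright, sub_self, mul_zero]

/-- A finite-dimensional semiprime algebra is a product of matrix algebras over division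
algebras. -/
theorem exists_linearEquiv_pi_matrix_of_semiprime.{u} {F : Type*} {A : Type u} [Field F]
    [NonUnitalRing A] [Module F A] [SMulCommClass F A A] [IsScalarTower F A A]
    [FiniteDimensional F A] (hA : ∀ a : A, (∀ x : A, a * x * a = 0) → a = 0) :
    ∃ (r : ℕ) (n : Fin r → ℕ) (D : Fin r → Type u) (_ : ∀ i, DivisionRing (D i))
      (_ : ∀ i, Algebra F (D i)) (φ : A ≃ₗ[F] (∀ i, Matrix (Fin (n i)) (Fin (n i)) (D i))),
      (∀ i, 0 < n i) ∧ ∀ a b : A, φ (a * b) = φ a * φ b := by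
  obtain ⟨e, he⟩ := exists_unity_of_semiprime F hA
  let : Ring A :=
    { ‹NonUnitalRing A› with
      one := e
      one_mul := fun a => (he a).1
      mul_one := fun a => (he a).2 }
  let : Algebra F A := Algebra.ofModule smul_mul_assoc mul_smul_comm
  have := Unitization.isSemisimpleRing (F := F) hA
  have : IsSemisimpleRing A :=
    (Unitization.lift (NonUnitalAlgHom.id F A)).toRingHom.isSemisimpleRing_of_surjective
      fun a => ⟨(a : Unitization F A), by simp⟩
  obtain ⟨r, D, n, _, _, hn, ⟨φ⟩⟩ := IsSemisimpleRing.exists_algEquiv_pi_matrix_divisionRing F A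
  exact ⟨r, n, D, _, _, φ.toLinearEquiv, fun i => (hn i).pos, map_mul φ⟩

/-- A product of matrix rings over division rings is semiprime. -/
theorem Pi.matrix_semiprime {ι : Type*} [DecidableEq ι] {n : ι → Type*} [∀ i, Fintype (n i)]
    [∀ i, DecidableEq (n i)] {D : ι → Type*} [∀ i, DivisionRing (D i)]
    (a : ∀ i, Matrix (n i) (n i) (D i)) (ha : ∀ x, a * x * a = 0) : a = 0 := by
  funext i
  ext j k
  by_contra h
  have := congrFun (congrFun (congrFun (ha (Pi.single i (Matrix.single k j (a i j k)⁻¹))) i) j) k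
  rw [Pi.mul_apply, Pi.mul_apply, Pi.single_eq_same, Matrix.mul_assoc, Matrix.mul_apply,
    Finset.sum_eq_single k (fun l _ hl => by simp [hl]) (by simp),
    Matrix.single_mul_apply_same] at this
  simp_all

/-- Wedderburn's theorem for semiprime algebras: a nonzero finite-dimensional
(not necessarily unital) algebra `A` over a field `F` is semiprime if and only if
`A ≅ M_{n₁}(D₁) × … × M_{n_r}(D_r)` for some `r ≥ 1`, positive integers `nᵢ`, and
division algebras `Dᵢ` over `F`. The isomorphism is expressed as an `F`-linear
multiplicative bijection onto the direct product. -/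
theorem wedderburn_semiprime
    (F : Type) [Field F] (A : Type) [NonUnitalRing A] [Module F A]
    [SMulCommClass F A A] [IsScalarTower F A A]
    [FiniteDimensional F A] [Nontrivial A] :
    (∀ a : A, (∀ x : A, a * x * a = 0) → a = 0) ↔
      ∃ r : ℕ, 0 < r ∧
        ∃ n : Fin r → ℕ, (∀ i, 0 < n i) ∧
          ∃ (D : Fin r → Type) (_ : ∀ i, DivisionRing (D i)) (_ : ∀ i, Algebra F (D i)),
            ∃ φ : A ≃ₗ[F] (∀ i, Matrix (Fin (n i)) (Fin (n i)) (D i)),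
              ∀ a b : A, φ (a * b) = φ a * φ b := by
  constructor
  · intro hA
    obtain ⟨r, n, D, _, _, φ, hn, hφ⟩ := exists_linearEquiv_pi_matrix_of_semiprime (F := F) hA
    refine ⟨r, Nat.pos_of_ne_zero ?_, n, hn, D, _, _, φ, hφ⟩
    rintro rfl
    exact not_subsingleton A φ.injective.subsingleton
  · rintro ⟨r, -, n, -, D, _, _, φ, hφ⟩ a ha
    refine φ.map_eq_zero_iff.1 (Pi.matrix_semiprime (φ a) fun x => ?_)
    obtain ⟨y, rfl⟩ := φ.surjective x
    rw [← hφ, ← hφ, ha, map_zero]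
end

section
/- A nonzero finite-dimensional algebra A over a field F (not assumed to have a unity) is prime if and only if it is simple. -/
section Semiprime

variable {F A : Type*} [Field F] [NonUnitalRing A] [Module F A]
  [SMulCommClass F A A] [FiniteDimensional F A]

/-- In a finite-dimensional semiprime algebra, every nonzero right ideal contains a nonzero
idempotent. -/
theorem exists_idempotent_ne_zero_of_rightIdeal
    (hA : ∀ a : A, (∀ x : A, a * x * a = 0) → a = 0) (R : Submodule F A)
    (hR : ∀ x ∈ R, ∀ a : A, x * a ∈ R) (hR0 : R ≠ ⊥) :
    ∃ e ∈ R, e * e = e ∧ e ≠ 0 := by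
  obtain ⟨M, ⟨hM, hMR, hM0⟩, hmin⟩ := WellFounded.has_min
    (wellFounded_lt : WellFounded ((· < ·) : Submodule F A → Submodule F A → Prop))
    {M | (∀ x ∈ M, ∀ a : A, x * a ∈ M) ∧ M ≤ R ∧ M ≠ ⊥} ⟨R, hR, le_rfl, hR0⟩
  have eq_of_le : ∀ N : Submodule F A, (∀ x ∈ N, ∀ a : A, x * a ∈ N) → N ≤ M → N ≠ ⊥ →
      N = M := fun N hN hNM hN0 =>
    hNM.eq_of_not_lt (hmin N ⟨hN, hNM.trans hMR, hN0⟩)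
  obtain ⟨m, hm, n, hn, hmn⟩ : ∃ m ∈ M, ∃ n ∈ M, m * n ≠ 0 := by
    by_contra! h
    exact hM0 ((Submodule.eq_bot_iff M).2 fun x hx => hA x fun a => h _ (hM x hx a) x hx)
  have hmap : M.map (LinearMap.mulLeft F m) = M := by
    refine eq_of_le _ ?_ ?_ ?_
    · rintro _ ⟨x, hx, rfl⟩ a
      exact ⟨x * a, hM x hx a, (mul_assoc m x a).symm⟩
    · rintro _ ⟨x, -, rfl⟩
      exact hM m hm x
    · exact (Submodule.ne_bot_iff _).2 ⟨m * n, ⟨n, hn, rfl⟩, hmn⟩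
  have hker : M ⊓ LinearMap.ker (LinearMap.mulLeft F m) = ⊥ := by
    by_contra h0
    have h := eq_of_le _ ?_ inf_le_left h0
    · exact hmn (h.ge hn).2
    · rintro x ⟨hx, hmx⟩ a
      have hmx : m * x = 0 := hmx
      exact ⟨hM x hx a, show m * (x * a) = 0 by rw [← mul_assoc, hmx, zero_mul]⟩
  obtain ⟨e, he, hme⟩ := hmap.ge hm
  have hme : m * e = m := hme
  refine ⟨e, hMR he, ?_, ?_⟩
  · have h : e * e - e ∈ M ⊓ LinearMap.ker (LinearMap.mulLeft F m) :=
      ⟨M.sub_mem (hM e he e) he, show m * (e * e - e) = 0 by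
        rw [mul_sub, ← mul_assoc, hme, hme, sub_self]⟩
    rw [hker, Submodule.mem_bot] at h
    exact sub_eq_zero.1 h
  · rintro rfl
    rw [mul_zero] at hme
    exact hmn (by rw [← hme, zero_mul])

/-- In a finite-dimensional semiprime algebra, every right ideal has a left identity. -/
theorem exists_left_identity_of_rightIdeal
    (hA : ∀ a : A, (∀ x : A, a * x * a = 0) → a = 0) (I : Submodule F A)
    (hI : ∀ x ∈ I, ∀ a : A, x * a ∈ I) :
    ∃ e ∈ I, ∀ x ∈ I, e * x = x := by
  obtain ⟨_, ⟨e, he, hee, rfl⟩, hmin⟩ := WellFounded.has_min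
    (wellFounded_lt : WellFounded ((· < ·) : Submodule F A → Submodule F A → Prop))
    {K | ∃ e ∈ I, e * e = e ∧ I ⊓ LinearMap.ker (LinearMap.mulLeft F e) = K}
    ⟨_, 0, I.zero_mem, mul_zero 0, rfl⟩
  refine ⟨e, he, ?_⟩
  have hK : I ⊓ LinearMap.ker (LinearMap.mulLeft F e) = ⊥ := by
    by_contra h0
    obtain ⟨f, ⟨hf, hef⟩, hff, hf0⟩ := exists_idempotent_ne_zero_of_rightIdeal hA _ (by
      rintro x ⟨hx, hex⟩ a
      have hex : e * x = 0 := hex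
      exact ⟨hI x hx a, show e * (x * a) = 0 by rw [← mul_assoc, hex, zero_mul]⟩) h0
    have hef : e * f = 0 := hef
    have heg : e * (e + f - f * e) = e := by
      rw [mul_sub, mul_add, hee, hef, ← mul_assoc, hef, zero_mul, add_zero, sub_zero]
    have hfg : f * (e + f - f * e) = f := by
      rw [mul_sub, mul_add, hff, ← mul_assoc, hff, add_sub_cancel_left]
    refine hmin _ ⟨e + f - f * e, I.sub_mem (I.add_mem he hf) (hI f hf e), ?_, rfl⟩ ?_
    · rw [sub_mul, add_mul, mul_assoc f e, heg, hfg]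
    · refine lt_of_le_of_ne ?_ fun h => ?_
      · rintro x ⟨hx, hgx⟩
        have hgx : (e + f - f * e) * x = 0 := hgx
        exact ⟨hx, show e * x = 0 by rw [← heg, mul_assoc, hgx, mul_zero]⟩
      · have hgf : (e + f - f * e) * f = 0 := (h.ge ⟨hf, hef⟩).2
        rw [sub_mul, add_mul, mul_assoc f e, hef, hff, mul_zero, zero_add, sub_zero] at hgf
        exact hf0 hgf
  intro x hx
  have h : e * x - x ∈ I ⊓ LinearMap.ker (LinearMap.mulLeft F e) :=
    ⟨I.sub_mem (hI e he x) hx, show e * (e * x - x) = 0 by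
      rw [mul_sub, ← mul_assoc, hee, sub_self]⟩
  rw [hK, Submodule.mem_bot] at h
  exact sub_eq_zero.1 h

end Semiprime

/-- A nonzero finite-dimensional (not necessarily unital) algebra over a field `F`
is prime if and only if it is simple (its only two-sided ideals are `{0}` and the
whole algebra, and some product of two elements is nonzero). -/
theorem prime_iff_simple_finiteDimensional
    (F : Type) [Field F] (A : Type) [NonUnitalRing A] [Module F A]
    [SMulCommClass F A A] [IsScalarTower F A A]
    [FiniteDimensional F A] [Nontrivial A] :
    (∀ a b : A, (∀ x : A, a * x * b = 0) → a = 0 ∨ b = 0) ↔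
      ((∀ I : Submodule F A,
          (∀ a : A, ∀ x ∈ I, a * x ∈ I ∧ x * a ∈ I) → I = ⊥ ∨ I = ⊤) ∧
        ∃ a b : A, a * b ≠ 0) := by
  constructor
  · intro hA
    have hA' : ∀ a : A, (∀ x : A, a * x * a = 0) → a = 0 := fun a h => (hA a a h).elim id id
    refine ⟨fun I hI => ?_, ?_⟩
    · obtain ⟨e, he, hid⟩ :=
        exists_left_identity_of_rightIdeal hA' I fun x hx a => (hI a x hx).2
      refine or_iff_not_imp_left.2 fun hI0 => (Submodule.eq_top_iff').2 fun a => ?_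
      obtain ⟨x, hx, hx0⟩ := (Submodule.ne_bot_iff I).1 hI0
      have h := (hA (a - e * a) x fun y => by
        rw [sub_mul, sub_mul, mul_assoc e, mul_assoc e,
          hid _ (hI (a * y) x hx).1, sub_self]).resolve_right hx0
      rw [sub_eq_zero.1 h]
      exact (hI a e he).2
    · by_contra! h
      obtain ⟨a, ha⟩ := exists_ne (0 : A)
      exact ha (hA' a fun x => h _ _)
  · rintro ⟨hA, c, d, hcd⟩ a b hab
    have hann : ∀ x : A, (∀ y, x * y = 0) → x = 0 := by
      let L : Submodule F A :=
        { carrier := {x | ∀ y, x * y = 0}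
          zero_mem' := zero_mul
          add_mem' := fun hx hy z => by rw [add_mul, hx z, hy z, add_zero]
          smul_mem' := fun r x hx y => by rw [smul_mul_assoc, hx y, smul_zero] }
      have hL : L = ⊥ := (hA L fun z x hx =>
        ⟨fun y => by rw [mul_assoc, hx y, mul_zero],
          fun y => by rw [mul_assoc, hx (z * y)]⟩).resolve_right fun h =>
        hcd ((h.ge (Submodule.mem_top : c ∈ ⊤) : c ∈ L) d)
      intro x hx
      exact (Submodule.eq_bot_iff L).1 hL x hx
    let K : Submodule F A :=
      { carrier := {z | ∀ x, a * x * z = 0}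
        zero_mem' := fun x => mul_zero _
        add_mem' := fun hx hy z => by rw [mul_add, hx z, hy z, add_zero]
        smul_mem' := fun r x hx y => by rw [mul_smul_comm, hx y, smul_zero] }
    rcases hA K fun y z hz =>
      ⟨fun x => by rw [← mul_assoc, mul_assoc a, hz (x * y)],
        fun x => by rw [← mul_assoc, hz x, zero_mul]⟩ with hK | hK
    · exact Or.inr ((Submodule.eq_bot_iff K).1 hK b hab)
    · exact Or.inl (hann a fun x => hann _ fun z =>
        (hK.ge (Submodule.mem_top : z ∈ ⊤) : z ∈ K) x)
end
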